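/- Let H be a real Hilbert space, assume (H1), (H2), (H3) and the strengthened hypothesis (H'3,1): there exist non-negative functions α ∈ L¹([T0,T],ℝ) and g ∈ L¹(Q_Δ,ℝ) such that ‖f2(t,s,x)‖ ≤ g(t,s) + α(t)·‖x‖ for all (t,s) ∈ Q_Δ and all x ∈ ⋃_{t∈[T0,T]} C(t). For each a ∈ C(T0) denote by x_a the unique absolutely continuous solution of −x'(t) ∈ N_{C(t)}(x(t)) + f1(t,x(t)) + ∫_{T0}^t f2(t,s,x(s)) ds a.e. on [T0,T] with x(T0) = a. Then the map ψ : a ↦ x_a from C(T0) into the space C([T0,T],H) of continuous mappings endowed with the supremum norm is Lipschitz continuous on every bounded subset of C(T0); more precisely, for every M > 0 there exists a constant c(M) such that sup_{t∈[T0,T]} ‖x_b(t) − x_a(t)‖ ≤ c(M)·‖b − a‖ for all a, b ∈ C(T0) with ‖a‖ ≤ M and ‖b‖ ≤ M. -/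

import Mathlib

open MeasureTheory Set
open scoped RealInnerProductSpace ENNReal Pointwise NNReal

noncomputable section

variable {H : Type*} [NormedAddCommGroup H] [InnerProductSpace ℝ H]

/-- The proximal normal cone of `S` at `x`. -/
def proxNormalCone (S : Set H) (x : H) : Set H :=
  {v | ∃ σ : ℝ, 0 ≤ σ ∧ ∃ δ : ℝ, 0 < δ ∧
    ∀ y ∈ S ∩ Metric.ball x δ, ⟪v, y - x⟫ ≤ σ * ‖y - x‖ ^ 2}

/-- Uniform `r`-prox-regularity, `r ∈ (0, ∞]`. -/
def IsProxRegular (r : ℝ≥0∞) (S : Set H) : Prop :=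
  ∀ x ∈ S, ∀ v ∈ proxNormalCone S x, v ≠ 0 →
    ∀ y ∈ S, ⟪‖v‖⁻¹ • v, y - x⟫ ≤ ((2 * r)⁻¹).toReal * ‖y - x‖ ^ 2

variable [CompleteSpace H]

/-- Absolutely continuous solution of the integro-differential sweeping process
`-x'(t) ∈ N_{C(t)}(x(t)) + f1(t, x(t)) + ∫_{T0}^t f2(t, s, x(s)) ds`. -/
def IsIDSweepingSol (T0 T : ℝ) (C : ℝ → Set H) (f1 : ℝ → H → H)
    (f2 : ℝ → ℝ → H → H) (x x' : ℝ → H) : Prop :=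
  IntervalIntegrable x' volume T0 T ∧
  (∀ t ∈ Icc T0 T, x t = x T0 + ∫ s in T0..t, x' s) ∧
  (∀ t ∈ Icc T0 T, x t ∈ C t) ∧
  (∀ᵐ t ∂volume, t ∈ Icc T0 T →
    (-x' t - f1 t (x t) - ∫ s in T0..t, f2 t s (x s)) ∈ proxNormalCone (C t) (x t))

theorem ac_of_dist_le {X Y : Type*} [PseudoMetricSpace X] [PseudoMetricSpace Y]
    {p : ℝ → X} {q : ℝ → Y} {a b K : ℝ}
    (hp : AbsolutelyContinuousOnInterval p a b)
    (h : ∀ x ∈ uIcc a b, ∀ y ∈ uIcc a b, dist (q x) (q y) ≤ K * dist (p x) (p y)) :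
    AbsolutelyContinuousOnInterval q a b := by
  unfold AbsolutelyContinuousOnInterval at hp ⊢
  apply squeeze_zero' ?_ ?_ (by simpa using (hp.const_mul K))
  · exact Filter.Eventually.of_forall <| fun _ ↦ Finset.sum_nonneg (fun i hi ↦ dist_nonneg)
  rw [Filter.eventually_inf_principal]
  filter_upwards with E hE
  rw [Finset.mul_sum]
  exact Finset.sum_le_sum fun i hi => h _ (hE.1 i hi).1 _ (hE.1 i hi).2

theorem ac_exp {p : ℝ → ℝ} {a b : ℝ} (hp : AbsolutelyContinuousOnInterval p a b) :
    AbsolutelyContinuousOnInterval (fun t => Real.exp (p t)) a b := by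
  obtain ⟨B, hB⟩ := hp.exists_bound
  have hcd : ContDiffOn ℝ 1 Real.exp (Icc (-B) B) := Real.contDiff_exp.contDiffOn
  obtain ⟨K, hK⟩ := hcd.exists_lipschitzOnWith (by decide) (convex_Icc _ _) isCompact_Icc
  refine ac_of_dist_le (K := K) hp fun x hx y hy => ?_
  exact hK.dist_le_mul _ (abs_le.1 (hB x hx)) _ (abs_le.1 (hB y hy))

theorem gronwall_L1 {T0 T u0 : ℝ} (hT : T0 ≤ T) {p R : ℝ → ℝ}
    (hp : IntervalIntegrable p volume T0 T) (hR : IntervalIntegrable R volume T0 T)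
    (h : ∀ᵐ t, t ∈ Icc T0 T → p t ≤ R t * (u0 + ∫ s in T0..t, p s)) :
    ∀ t ∈ Icc T0 T, u0 + ∫ s in T0..t, p s ≤ u0 * Real.exp (∫ s in T0..t, R s) := by
  intro t ht
  have hsub : uIcc T0 t ⊆ uIcc T0 T := by
    rw [uIcc_of_le ht.1, uIcc_of_le hT]; exact Icc_subset_Icc_right ht.2
  have hpac := (hp.absolutelyContinuousOnInterval_intervalIntegral (c := T0) (by simp)).mono hsub
  have hRac := (hR.absolutelyContinuousOnInterval_intervalIntegral (c := T0) (by simp)).mono hsub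
  have huac : AbsolutelyContinuousOnInterval (fun t => u0 + ∫ s in T0..t, p s) T0 t :=
    ac_of_dist_le (K := 1) hpac (by intro x _ y _; simp)
  have hEac := ac_exp hRac.fun_neg
  have hprod := huac.fun_mul hEac
  have hftc := hprod.integral_deriv_eq_sub
  have hle : (∫ s in T0..t, deriv (fun t => (u0 + ∫ s in T0..t, p s) *
      Real.exp (-∫ s in T0..t, R s)) s) ≤ 0 := by
    rw [intervalIntegral.integral_of_le ht.1]
    apply integral_nonpos_of_ae
    rw [Filter.EventuallyLE, ae_restrict_iff' measurableSet_Ioc]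
    filter_upwards [hp.ae_hasDerivAt_integral, hR.ae_hasDerivAt_integral, h] with s h1 h2 h3 hs
    have hs' : s ∈ Icc T0 T := ⟨hs.1.le, hs.2.trans ht.2⟩
    have hsu : s ∈ uIcc T0 T := by rwa [uIcc_of_le hT]
    have d1 := (h1 hsu T0 (by simp)).const_add u0
    have d2 := (h2 hsu T0 (by simp)).fun_neg.exp
    rw [(d1.fun_mul d2).deriv]
    have := h3 hs'
    have e := Real.exp_pos (-∫ s in T0..s, R s)
    simp only [Pi.zero_apply]
    nlinarith
  rw [hftc] at hle
  simp only [intervalIntegral.integral_same, add_zero, neg_zero, Real.exp_zero, mul_one,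
    Real.exp_neg] at hle
  have e := Real.exp_pos (∫ s in T0..t, R s)
  rw [sub_nonpos, ← div_eq_mul_inv, div_le_iff₀ e] at hle
  exact hle

theorem cone_ineq {r : ℝ≥0∞} {S : Set H} (hS : IsProxRegular r S) {x v y : H} (hx : x ∈ S)
    (hv : v ∈ proxNormalCone S x) (hy : y ∈ S) :
    ⟪v, y - x⟫ ≤ ((2 * r)⁻¹).toReal * ‖v‖ * ‖y - x‖ ^ 2 := by
  by_cases h0 : v = 0
  · simp [h0]
  have h := hS x hx v hv h0 y hy
  have hn : 0 < ‖v‖ := norm_pos_iff.2 h0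
  rw [real_inner_smul_left, inv_mul_le_iff₀ hn] at h
  linarith

theorem normal_bound {r : ℝ≥0∞} {S : Set H} (hS : IsProxRegular r S) {x : ℝ → H} {x' ζ F : H}
    {υ : ℝ → ℝ} {υ' t : ℝ} (hx : HasDerivAt x x' t) (hυ : HasDerivAt υ υ' t) (hxt : x t ∈ S)
    (hmv : ∀ᶠ s in nhds t, x s ∈ S + |υ t - υ s| • Metric.closedBall (0 : H) 1)
    (hζ : ζ ∈ proxNormalCone S (x t)) (hF : ζ = -x' - F) : ‖ζ‖ ≤ |υ'| + ‖F‖ := by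
  set κ := ((2 * r)⁻¹).toReal with hκ
  have hκ0 : 0 ≤ κ := ENNReal.toReal_nonneg
  have hle : nhdsWithin t (Iio t) ≤ nhdsWithin t {t}ᶜ :=
    nhdsWithin_mono _ (fun s hs => ne_of_lt hs)
  have sx := (hasDerivAt_iff_tendsto_slope.1 hx).mono_left hle
  have sυ := (hasDerivAt_iff_tendsto_slope.1 hυ).mono_left hle
  have ht : Filter.Tendsto (fun s => t - s) (nhdsWithin t (Iio t)) (nhds 0) := by
    have : Filter.Tendsto (fun s => t - s) (nhds t) (nhds (t - t)) :=
      (continuous_const.sub continuous_id).tendsto t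
    rw [sub_self] at this
    exact this.mono_left nhdsWithin_le_nhds
  have lim1 : Filter.Tendsto (fun s => ⟪ζ, -slope x t s⟫) (nhdsWithin t (Iio t))
      (nhds ⟪ζ, -x'⟫) := tendsto_const_nhds.inner sx.neg
  have lim2 : Filter.Tendsto (fun s => ‖ζ‖ * |slope υ t s| +
      κ * ‖ζ‖ * (‖slope x t s‖ + |slope υ t s|) ^ 2 * (t - s)) (nhdsWithin t (Iio t))
      (nhds (‖ζ‖ * |υ'| + κ * ‖ζ‖ * (‖x'‖ + |υ'|) ^ 2 * 0)) :=
    (sυ.abs.const_mul _).add ((((sx.norm.add sυ.abs).pow 2).const_mul _).mul ht)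
  have key : ⟪ζ, -x'⟫ ≤ ‖ζ‖ * |υ'| + κ * ‖ζ‖ * (‖x'‖ + |υ'|) ^ 2 * 0 := by
    refine le_of_tendsto_of_tendsto lim1 lim2 ?_
    filter_upwards [nhdsWithin_le_nhds hmv, self_mem_nhdsWithin] with s hs hst
    have hd : 0 < t - s := sub_pos.2 hst
    obtain ⟨y, hy, e, he, hye⟩ := hs
    obtain ⟨e', he', rfl⟩ := he
    have hen : ‖|υ t - υ s| • e'‖ ≤ |υ s - υ t| := by
      rw [norm_smul, Real.norm_eq_abs, abs_abs, abs_sub_comm]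
      have : ‖e'‖ ≤ 1 := by simpa using he'
      exact mul_le_of_le_one_right (abs_nonneg _) this
    set e := |υ t - υ s| • e' with hee
    simp only at hye
    have hx1 : x s - x t = (t - s) • (-slope x t s) := by
      rw [slope_def_module, ← neg_smul, smul_smul]
      have : (t - s) * -(s - t)⁻¹ = 1 := by
        have : s - t ≠ 0 := by linarith
        field_simp; ring
      simp [this]
    have hυ1 : |υ s - υ t| = (t - s) * |slope υ t s| := by
      rw [slope_def_field, abs_div, abs_sub_comm s t, abs_of_pos hd]; field_simp
    have hin := cone_ineq hS hxt hζ hy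
    have hyx : y - x t = (x s - x t) - e := by rw [← hye]; abel
    have h1 : ⟪ζ, x s - x t⟫ = ⟪ζ, y - x t⟫ + ⟪ζ, e⟫ := by
      rw [hyx, inner_sub_right _ _ e]; ring
    have h2 : ⟪ζ, e⟫ ≤ ‖ζ‖ * |υ s - υ t| :=
      (real_inner_le_norm _ _).trans (mul_le_mul_of_nonneg_left hen (norm_nonneg _))
    have h3 : ‖y - x t‖ ≤ ‖x s - x t‖ + |υ s - υ t| := by
      rw [hyx]; exact (norm_sub_le _ _).trans (by linarith)
    have h4 : ‖x s - x t‖ = (t - s) * ‖slope x t s‖ := by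
      rw [hx1, norm_smul, Real.norm_of_nonneg hd.le, norm_neg]
    have h5 : ‖y - x t‖ ^ 2 ≤ ((t - s) * (‖slope x t s‖ + |slope υ t s|)) ^ 2 := by
      apply pow_le_pow_left₀ (norm_nonneg _)
      rw [h4, hυ1] at h3; linarith
    have h6 : κ * ‖ζ‖ * ‖y - x t‖ ^ 2 ≤
        κ * ‖ζ‖ * ((t - s) * (‖slope x t s‖ + |slope υ t s|)) ^ 2 :=
      mul_le_mul_of_nonneg_left h5 (by positivity)
    have h7 : (t - s) * ⟪ζ, -slope x t s⟫ ≤ (t - s) * (‖ζ‖ * |slope υ t s| +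
        κ * ‖ζ‖ * (‖slope x t s‖ + |slope υ t s|) ^ 2 * (t - s)) := by
      rw [← real_inner_smul_right, ← hx1, h1]
      rw [hυ1] at h2
      nlinarith
    exact le_of_mul_le_mul_left h7 hd
  have hx' : -x' = ζ + F := by rw [hF]; abel
  rw [hx', inner_add_right, real_inner_self_eq_norm_sq] at key
  have hcs : -(‖ζ‖ * ‖F‖) ≤ ⟪ζ, F⟫ := (abs_le.1 (abs_real_inner_le_norm ζ F)).1
  by_cases h0 : ‖ζ‖ = 0
  · rw [h0]; positivity
  have hpos : 0 < ‖ζ‖ := lt_of_le_of_ne (norm_nonneg _) (Ne.symm h0)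
  refine le_of_mul_le_mul_left ?_ hpos
  nlinarith
theorem sol_hasDerivAt {E : Type*} [NormedAddCommGroup E] [NormedSpace ℝ E] [CompleteSpace E]
    {T0 T : ℝ} {x x' : ℝ → E} (hT : T0 < T)
    (hi : IntervalIntegrable x' volume T0 T)
    (hx : ∀ t ∈ Icc T0 T, x t = x T0 + ∫ s in T0..t, x' s) :
    ∀ᵐ t, t ∈ Icc T0 T → t ∈ Ioo T0 T ∧ HasDerivAt x (x' t) t := by
  have h₁ : ∀ᵐ x : ℝ, x ≠ T0 := by simp [ae_iff, measure_singleton]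
  have h₂ : ∀ᵐ x : ℝ, x ≠ T := by simp [ae_iff, measure_singleton]
  filter_upwards [hi.ae_hasDerivAt_integral, h₁, h₂] with t h ht1 ht2 ht
  have hI : t ∈ Ioo T0 T := ⟨lt_of_le_of_ne ht.1 (Ne.symm ht1), lt_of_le_of_ne ht.2 ht2⟩
  refine ⟨hI, ?_⟩
  have hd := (h (by rwa [uIcc_of_le hT.le]) T0 (by simp)).const_add (x T0)
  refine hd.congr_of_eventuallyEq ?_
  filter_upwards [Icc_mem_nhds hI.1 hI.2] with s hs using hx s hs

theorem sol_continuousOn {E : Type*} [NormedAddCommGroup E] [NormedSpace ℝ E]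
    {T0 T : ℝ} {x x' : ℝ → E} (hT : T0 < T)
    (hi : IntervalIntegrable x' volume T0 T)
    (hx : ∀ t ∈ Icc T0 T, x t = x T0 + ∫ s in T0..t, x' s) : ContinuousOn x (Icc T0 T) := by
  have h := intervalIntegral.continuousOn_primitive_interval' hi (left_mem_uIcc)
  rw [uIcc_of_le hT.le] at h
  exact (continuousOn_const.add h).congr hx

theorem ii_mono {E : Type*} [NormedAddCommGroup E] {T0 T a b : ℝ} {f : ℝ → E}
    (hi : IntervalIntegrable f volume T0 T) (ha : a ∈ Icc T0 T) (hb : b ∈ Icc T0 T) :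
    IntervalIntegrable f volume a b := by
  apply hi.mono_set
  rw [uIcc_of_le (ha.1.trans ha.2)]
  exact uIcc_subset_Icc ha hb

theorem sq_ftc {T0 T : ℝ} {w w' : ℝ → H} (hT : T0 < T)
    (hi : IntervalIntegrable w' volume T0 T)
    (hw : ∀ t ∈ Icc T0 T, w t = w T0 + ∫ s in T0..t, w' s) :
    ∀ t ∈ Icc T0 T, ‖w t‖ ^ 2 = ‖w T0‖ ^ 2 + ∫ s in T0..t, 2 * ⟪w s, w' s⟫ := by
  intro t ht
  have hcont := sol_continuousOn hT hi hw
  obtain ⟨B, hB⟩ := isCompact_Icc.exists_bound_of_continuousOn hcont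
  have hV := hi.norm.absolutelyContinuousOnInterval_intervalIntegral (c := T0) (by simp)
  have hac : AbsolutelyContinuousOnInterval (fun t => ‖w t‖ ^ 2) T0 T := by
    refine ac_of_dist_le (K := 2 * B) hV fun x hx y hy => ?_
    rw [uIcc_of_le hT.le] at hx hy
    have hsub : w x - w y = ∫ s in y..x, w' s := by
      rw [hw x hx, hw y hy, add_sub_add_left_eq_sub]
      exact intervalIntegral.integral_interval_sub_left
        (ii_mono hi (left_mem_Icc.2 hT.le) hx) (ii_mono hi (left_mem_Icc.2 hT.le) hy)
    have h1 : ‖w x - w y‖ ≤ dist (∫ s in T0..x, ‖w' s‖) (∫ s in T0..y, ‖w' s‖) := by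
      rw [Real.dist_eq, intervalIntegral.integral_interval_sub_left
        (ii_mono hi.norm (left_mem_Icc.2 hT.le) hx) (ii_mono hi.norm (left_mem_Icc.2 hT.le) hy),
        hsub]
      exact intervalIntegral.norm_integral_le_abs_integral_norm
    have h2 := hB x hx
    have h3 := hB y hy
    have h4 := abs_norm_sub_norm_le (w x) (w y)
    rw [Real.dist_eq, show ‖w x‖ ^ 2 - ‖w y‖ ^ 2 = (‖w x‖ + ‖w y‖) * (‖w x‖ - ‖w y‖) by ring,
      abs_mul, abs_of_nonneg (by positivity)]
    exact mul_le_mul (by linarith) (h4.trans h1) (abs_nonneg _) (by linarith [norm_nonneg (w x)])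
  have hsub : uIcc T0 t ⊆ uIcc T0 T := by
    rw [uIcc_of_le ht.1, uIcc_of_le hT.le]; exact Icc_subset_Icc_right ht.2
  have hftc := (hac.mono hsub).integral_deriv_eq_sub
  have hcg : (∫ s in T0..t, deriv (fun t => ‖w t‖ ^ 2) s) = ∫ s in T0..t, 2 * ⟪w s, w' s⟫ := by
    apply intervalIntegral.integral_congr_ae
    filter_upwards [sol_hasDerivAt hT hi hw] with s hs hst
    rw [uIoc_of_le ht.1] at hst
    exact ((hs ⟨hst.1.le, hst.2.trans ht.2⟩).2.norm_sq).deriv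
  rw [← hcg, hftc]; ring

theorem aesm_caratheodory {T0 t η : ℝ} (f : ℝ → H → H) (L : ℝ)
    (hf : ∀ x, StronglyMeasurable fun s => f s x)
    (hL : ∀ s ∈ Icc T0 t, ∀ x ∈ Metric.closedBall (0 : H) η,
        ∀ y ∈ Metric.closedBall (0 : H) η, ‖f s x - f s y‖ ≤ L * ‖x - y‖)
    (x : ℝ → H) (hx : ContinuousOn x (Icc T0 t)) (hη : 0 < η)
    (hxb : ∀ s ∈ Icc T0 t, ‖x s‖ ≤ η) :
    AEStronglyMeasurable (fun s => f s (x s)) (volume.restrict (Icc T0 t)) := by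
  obtain ⟨y, hy, hxy⟩ := hx.aestronglyMeasurable (μ := volume) measurableSet_Icc
  let φ := fun n => hy.approxBounded η n
  have hφn : ∀ n s, ‖φ n s‖ ≤ η := fun n s => hy.norm_approxBounded_le hη.le n s
  refine aestronglyMeasurable_of_tendsto_ae Filter.atTop (f := fun n s => f s (φ n s)) ?_ ?_
  · intro n
    refine StronglyMeasurable.aestronglyMeasurable ?_
    have : (fun s => f s (φ n s)) = fun s => ∑ c ∈ (φ n).range,
        (φ n ⁻¹' {c}).indicator (fun s => f s c) s := by
      funext s
      rw [Finset.sum_eq_single (φ n s)]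
      · simp
      · intro c _ hc
        rw [indicator_of_notMem]
        simpa using hc.symm
      · intro h; exact absurd ((φ n).mem_range_self s) h
    rw [this]
    exact Finset.stronglyMeasurable_fun_sum _ fun c _ =>
      (hf c).indicator ((φ n).measurableSet_fiber c)
  · filter_upwards [hxy, ae_restrict_mem measurableSet_Icc] with s hs hst
    have hyb : ‖y s‖ ≤ η := hs ▸ hxb s hst
    have ht := hy.tendsto_approxBounded_of_norm_le hyb
    rw [hs, tendsto_iff_norm_sub_tendsto_zero]
    have h0 : Filter.Tendsto (fun n => L * ‖φ n s - y s‖) Filter.atTop (nhds 0) := by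
      simpa using ((tendsto_iff_norm_sub_tendsto_zero.1 ht).const_mul L)
    refine squeeze_zero (fun _ => norm_nonneg _) (fun n => ?_) h0
    exact hL s hst _ (by simpa using hφn n s) _ (by simpa using hyb)
theorem slice_bound {T0 T : ℝ} {g : ℝ → ℝ → ℝ}
    (hgint : IntegrableOn (fun p : ℝ × ℝ => g p.1 p.2)
      {p : ℝ × ℝ | p.1 ∈ Icc T0 T ∧ p.2 ∈ Icc T0 T ∧ p.2 ≤ p.1} volume)
    (hgnn : ∀ t ∈ Icc T0 T, ∀ s ∈ Icc T0 t, 0 ≤ g t s) :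
    ∃ G : ℝ → ℝ, IntervalIntegrable G volume T0 T ∧ (∀ t, 0 ≤ G t) ∧
      ∀ᵐ t, t ∈ Icc T0 T → IntervalIntegrable (g t) volume T0 t ∧
        ∫ s in T0..t, g t s ≤ G t := by
  set Q := {p : ℝ × ℝ | p.1 ∈ Icc T0 T ∧ p.2 ∈ Icc T0 T ∧ p.2 ≤ p.1} with hQ
  have hQm : MeasurableSet Q :=
    (measurable_fst measurableSet_Icc).inter ((measurable_snd measurableSet_Icc).inter
      (measurableSet_le measurable_snd measurable_fst))
  set h : ℝ × ℝ → ℝ := Q.indicator (fun p => g p.1 p.2) with hh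
  have hi : Integrable h (volume.prod volume) := by
    rw [← Measure.volume_eq_prod]
    exact (integrable_indicator_iff hQm).2 hgint
  have hnn : ∀ p, 0 ≤ h p := by
    intro p
    apply indicator_nonneg
    rintro ⟨t, s⟩ ⟨h1, h2, h3⟩
    exact hgnn t h1 s ⟨h2.1, h3⟩
  refine ⟨fun t => ∫ s, h (t, s), hi.integral_prod_left.intervalIntegrable,
    fun t => integral_nonneg fun s => hnn _, ?_⟩
  filter_upwards [hi.prod_right_ae] with t hti ht
  have heq : EqOn (fun s => h (t, s)) (g t) (Ioc T0 t) := by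
    intro s hs
    exact indicator_of_mem (show (t, s) ∈ Q from ⟨ht, ⟨hs.1.le, hs.2.trans ht.2⟩, hs.2⟩) _
  refine ⟨?_, ?_⟩
  · rw [intervalIntegrable_iff_integrableOn_Ioc_of_le ht.1]
    exact (integrableOn_congr_fun heq measurableSet_Ioc).1 hti.integrableOn
  · rw [intervalIntegral.integral_of_le ht.1, ← setIntegral_congr_fun measurableSet_Ioc heq]
    exact setIntegral_le_integral hti (Filter.Eventually.of_forall fun s => hnn _)

theorem zeta_bound {T0 T : ℝ} (hT : T0 < T) {r : ℝ≥0∞} {C : ℝ → Set H}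
    (hC : ∀ t ∈ Icc T0 T, (C t).Nonempty ∧ IsClosed (C t) ∧ IsProxRegular r (C t))
    {υ υ' : ℝ → ℝ}
    (hυint : IntervalIntegrable υ' volume T0 T)
    (hυAC : ∀ t ∈ Icc T0 T, υ t = υ T0 + ∫ s in T0..t, υ' s)
    (hmove : ∀ s ∈ Icc T0 T, ∀ t ∈ Icc T0 T,
      C t ⊆ C s + |υ s - υ t| • Metric.closedBall (0 : H) 1)
    {x x' F : ℝ → H} (hi : IntervalIntegrable x' volume T0 T)
    (hx : ∀ t ∈ Icc T0 T, x t = x T0 + ∫ s in T0..t, x' s)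
    (hxC : ∀ t ∈ Icc T0 T, x t ∈ C t)
    (hN : ∀ᵐ t, t ∈ Icc T0 T → (-x' t - F t) ∈ proxNormalCone (C t) (x t)) :
    ∀ᵐ t, t ∈ Icc T0 T → ‖-x' t - F t‖ ≤ |υ' t| + ‖F t‖ := by
  filter_upwards [sol_hasDerivAt hT hi hx, sol_hasDerivAt hT hυint hυAC, hN] with t h1 h2 h3 ht
  refine normal_bound (hC t ht).2.2 (h1 ht).2 (h2 ht).2 (hxC t ht) ?_ (h3 ht) rfl
  filter_upwards [Icc_mem_nhds (h1 ht).1.1 (h1 ht).1.2] with s hs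
  exact hmove t ht s hs (hxC s hs)

/-- A priori bound from the differential estimate. -/
theorem apriori {T0 T : ℝ} (hT : T0 < T) {x x' : ℝ → H} {R : ℝ → ℝ}
    (hi : IntervalIntegrable x' volume T0 T)
    (hx : ∀ t ∈ Icc T0 T, x t = x T0 + ∫ s in T0..t, x' s)
    (hR : IntervalIntegrable R volume T0 T) (hRnn : ∀ t ∈ Icc T0 T, 0 ≤ R t)
    (h : ∀ᵐ t, t ∈ Icc T0 T → ∀ U, (∀ s ∈ Icc T0 t, ‖x s‖ ≤ U) → ‖x' t‖ ≤ R t * (1 + U)) :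
    ∀ t ∈ Icc T0 T, 1 + ‖x t‖ ≤ (1 + ‖x T0‖) * Real.exp (∫ s in T0..T, R s) := by
  have hT0 : T0 ∈ Icc T0 T := left_mem_Icc.2 hT.le
  have hxu : ∀ t ∈ Icc T0 T, ‖x t‖ ≤ ‖x T0‖ + ∫ s in T0..t, ‖x' s‖ := by
    intro t ht
    rw [hx t ht]
    exact (norm_add_le _ _).trans (add_le_add le_rfl
      (intervalIntegral.norm_integral_le_integral_norm ht.1))
  have hmono : ∀ t ∈ Icc T0 T, ∀ s ∈ Icc T0 t,
      ∫ u in T0..s, ‖x' u‖ ≤ ∫ u in T0..t, ‖x' u‖ := by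
    intro t ht s hs
    exact intervalIntegral.integral_mono_interval le_rfl hs.1 hs.2
      (Filter.Eventually.of_forall fun _ => norm_nonneg _) (ii_mono hi.norm hT0 ht)
  have hg := gronwall_L1 (u0 := 1 + ‖x T0‖) hT.le hi.norm hR (by
    filter_upwards [h] with t h ht
    have := h ht (‖x T0‖ + ∫ s in T0..t, ‖x' s‖) (fun s hs =>
      (hxu s ⟨hs.1, hs.2.trans ht.2⟩).trans (add_le_add le_rfl (hmono t ht s hs)))
    rw [add_assoc]; exact this)
  intro t ht
  have h1 := hg t ht
  have h2 := hxu t ht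
  have h3 : ∫ s in T0..t, R s ≤ ∫ s in T0..T, R s := by
    refine intervalIntegral.integral_mono_interval le_rfl ht.1 ht.2 ?_ hR
    rw [Filter.EventuallyLE, ae_restrict_iff' measurableSet_Ioc]
    exact Filter.Eventually.of_forall fun s hs => hRnn s ⟨hs.1.le, hs.2⟩
  have h4 := mul_le_mul_of_nonneg_left (Real.exp_le_exp.2 h3)
    (show 0 ≤ 1 + ‖x T0‖ by positivity)
  linarith

theorem energy {T0 T : ℝ} (hT : T0 < T) {w w' : ℝ → H} {R : ℝ → ℝ}
    (hi : IntervalIntegrable w' volume T0 T)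
    (hw : ∀ t ∈ Icc T0 T, w t = w T0 + ∫ s in T0..t, w' s)
    (hR : IntervalIntegrable R volume T0 T) (hRnn : ∀ t ∈ Icc T0 T, 0 ≤ R t)
    (h : ∀ᵐ t, t ∈ Icc T0 T → ∀ W, (∀ s ∈ Icc T0 t, ‖w s‖ ≤ W) →
      2 * ⟪w t, w' t⟫ ≤ R t * W ^ 2) :
    ∀ t ∈ Icc T0 T, ‖w t‖ ≤ Real.exp ((∫ s in T0..T, R s) / 2) * ‖w T0‖ := by
  have hT0 : T0 ∈ Icc T0 T := left_mem_Icc.2 hT.le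
  have hcont := sol_continuousOn hT hi hw
  have hpi : IntervalIntegrable (fun t => 2 * ⟪w t, w' t⟫) volume T0 T := by
    apply IntervalIntegrable.const_mul
    obtain ⟨B, hB⟩ := isCompact_Icc.exists_bound_of_continuousOn hcont
    rw [intervalIntegrable_iff_integrableOn_Ioc_of_le hT.le] at hi ⊢
    refine Integrable.mono' (g := fun t => B * ‖w' t‖) (hi.norm.const_mul B) ?_ ?_
    · exact ((hcont.mono Ioc_subset_Icc_self).aestronglyMeasurable measurableSet_Ioc).inner
        hi.aestronglyMeasurable
    · filter_upwards [ae_restrict_mem measurableSet_Ioc] with t ht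
      exact (norm_inner_le_norm _ _).trans
        (mul_le_mul_of_nonneg_right (hB t ⟨ht.1.le, ht.2⟩) (norm_nonneg _))
  have hqi : IntervalIntegrable (fun t => max (2 * ⟪w t, w' t⟫) 0) volume T0 T := by
    rw [intervalIntegrable_iff_integrableOn_Ioc_of_le hT.le] at hpi ⊢
    exact hpi.pos_part
  have hxu : ∀ t ∈ Icc T0 T, ‖w t‖ ^ 2 ≤
      ‖w T0‖ ^ 2 + ∫ s in T0..t, max (2 * ⟪w s, w' s⟫) 0 := by
    intro t ht
    rw [sq_ftc hT hi hw t ht]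
    gcongr
    exact intervalIntegral.integral_mono ht.1 (ii_mono hpi hT0 ht) (ii_mono hqi hT0 ht)
      fun s => le_max_left _ _
  have hmono : ∀ t ∈ Icc T0 T, ∀ s ∈ Icc T0 t,
      ∫ s in T0..s, max (2 * ⟪w s, w' s⟫) 0 ≤ ∫ s in T0..t, max (2 * ⟪w s, w' s⟫) 0 := by
    intro t ht s hs
    exact intervalIntegral.integral_mono_interval le_rfl hs.1 hs.2
      (Filter.Eventually.of_forall fun _ => le_max_right _ _) (ii_mono hqi hT0 ht)
  have hg := gronwall_L1 (u0 := ‖w T0‖ ^ 2) hT.le hqi hR (by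
    filter_upwards [h] with t h ht
    set Q := ‖w T0‖ ^ 2 + ∫ s in T0..t, max (2 * ⟪w s, w' s⟫) 0 with hQ
    have hQ0 : 0 ≤ Q := (sq_nonneg _).trans (hxu t ht)
    have := h ht (Real.sqrt Q) (fun s hs => Real.le_sqrt_of_sq_le
      ((hxu s ⟨hs.1, hs.2.trans ht.2⟩).trans (add_le_add le_rfl (hmono t ht s hs))))
    rw [Real.sq_sqrt hQ0] at this
    exact max_le this (mul_nonneg (hRnn t ht) hQ0))
  intro t ht
  have h1 := hg t ht
  have h2 := hxu t ht
  have h3 : ∫ s in T0..t, R s ≤ ∫ s in T0..T, R s := by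
    refine intervalIntegral.integral_mono_interval le_rfl ht.1 ht.2 ?_ hR
    rw [Filter.EventuallyLE, ae_restrict_iff' measurableSet_Ioc]
    exact Filter.Eventually.of_forall fun s hs => hRnn s ⟨hs.1.le, hs.2⟩
  have h4 := mul_le_mul_of_nonneg_left (Real.exp_le_exp.2 h3) (sq_nonneg ‖w T0‖)
  refine le_of_sq_le_sq ?_ (by positivity)
  have h5 : Real.exp ((∫ s in T0..T, R s) / 2) ^ 2 = Real.exp (∫ s in T0..T, R s) := by
    rw [← Real.exp_nat_mul]; congr 1; push_cast; ring
  rw [mul_pow, h5]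
  linarith
/-- Proposition 4.3: Lipschitz dependence of the solution on the initial value,
on bounded subsets of `C T0`. -/
theorem integro_differential_sweeping_lipschitz_dependence
    (T0 T : ℝ) (hT : T0 < T)
    (r : ℝ≥0∞) (hr : 0 < r)
    (C : ℝ → Set H)
    (hC : ∀ t ∈ Icc T0 T, (C t).Nonempty ∧ IsClosed (C t) ∧ IsProxRegular r (C t))
    (υ υ' : ℝ → ℝ)
    (hυint : IntervalIntegrable υ' volume T0 T)
    (hυAC : ∀ t ∈ Icc T0 T, υ t = υ T0 + ∫ s in T0..t, υ' s)
    (hmove : ∀ s ∈ Icc T0 T, ∀ t ∈ Icc T0 T,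
      C t ⊆ C s + |υ s - υ t| • Metric.closedBall (0 : H) 1)
    (f1 : ℝ → H → H)
    (hf1meas : ∀ x : H, StronglyMeasurable fun t => f1 t x)
    (β1 : ℝ → ℝ)
    (hβ1int : IntervalIntegrable β1 volume T0 T)
    (hβ1nn : ∀ t ∈ Icc T0 T, 0 ≤ β1 t)
    (hf1grow : ∀ t ∈ Icc T0 T, ∀ x ∈ ⋃ s ∈ Icc T0 T, C s, ‖f1 t x‖ ≤ β1 t * (1 + ‖x‖))
    (hf1lip : ∀ η : ℝ, 0 < η → ∃ L1 : ℝ → ℝ, IntervalIntegrable L1 volume T0 T ∧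
      (∀ t ∈ Icc T0 T, 0 ≤ L1 t) ∧
      ∀ t ∈ Icc T0 T, ∀ x ∈ Metric.closedBall (0 : H) η,
        ∀ y ∈ Metric.closedBall (0 : H) η, ‖f1 t x - f1 t y‖ ≤ L1 t * ‖x - y‖)
    (f2 : ℝ → ℝ → H → H)
    (hf2meas : ∀ x : H, StronglyMeasurable fun p : ℝ × ℝ => f2 p.1 p.2 x)
    (β2 : ℝ → ℝ → ℝ)
    (hβ2int : IntegrableOn (fun p : ℝ × ℝ => β2 p.1 p.2)
      {p : ℝ × ℝ | p.1 ∈ Icc T0 T ∧ p.2 ∈ Icc T0 T ∧ p.2 ≤ p.1} volume)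
    (hβ2nn : ∀ t ∈ Icc T0 T, ∀ s ∈ Icc T0 t, 0 ≤ β2 t s)
    (hf2grow : ∀ t ∈ Icc T0 T, ∀ s ∈ Icc T0 t, ∀ x ∈ ⋃ u ∈ Icc T0 T, C u,
      ‖f2 t s x‖ ≤ β2 t s * (1 + ‖x‖))
    (hf2lip : ∀ η : ℝ, 0 < η → ∃ L2 : ℝ → ℝ, IntervalIntegrable L2 volume T0 T ∧
      (∀ t ∈ Icc T0 T, 0 ≤ L2 t) ∧
      ∀ t ∈ Icc T0 T, ∀ s ∈ Icc T0 t, ∀ x ∈ Metric.closedBall (0 : H) η,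
        ∀ y ∈ Metric.closedBall (0 : H) η, ‖f2 t s x - f2 t s y‖ ≤ L2 t * ‖x - y‖)
    (al : ℝ → ℝ) (g : ℝ → ℝ → ℝ)
    (halint : IntervalIntegrable al volume T0 T)
    (halnn : ∀ t ∈ Icc T0 T, 0 ≤ al t)
    (hgint : IntegrableOn (fun p : ℝ × ℝ => g p.1 p.2)
      {p : ℝ × ℝ | p.1 ∈ Icc T0 T ∧ p.2 ∈ Icc T0 T ∧ p.2 ≤ p.1} volume)
    (hgnn : ∀ t ∈ Icc T0 T, ∀ s ∈ Icc T0 t, 0 ≤ g t s)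
    (hf2grow' : ∀ t ∈ Icc T0 T, ∀ s ∈ Icc T0 t, ∀ x ∈ ⋃ u ∈ Icc T0 T, C u,
      ‖f2 t s x‖ ≤ g t s + al t * ‖x‖)
    :
    ∀ M : ℝ, 0 < M → ∃ c : ℝ, ∀ a ∈ C T0, ∀ b ∈ C T0, ‖a‖ ≤ M → ‖b‖ ≤ M →
      ∀ xa xa' xb xb' : ℝ → H, xa T0 = a → xb T0 = b →
        IsIDSweepingSol T0 T C f1 f2 xa xa' → IsIDSweepingSol T0 T C f1 f2 xb xb' →
        ∀ t ∈ Icc T0 T, ‖xb t - xa t‖ ≤ c * ‖b - a‖ := by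
  intro M hM
  obtain ⟨G, hGint, hGnn, hG⟩ := slice_bound hgint hgnn
  set D := T - T0 with hD
  have hD0 : 0 < D := sub_pos.2 hT
  set R1 : ℝ → ℝ := fun t => |υ' t| + 2 * (β1 t + G t + al t * D) with hR1
  have hR1int : IntervalIntegrable R1 volume T0 T :=
    hυint.abs.add (((hβ1int.add hGint).add (halint.mul_const D)).const_mul 2)
  have hR1nn : ∀ t ∈ Icc T0 T, 0 ≤ R1 t := by
    intro t ht
    have h1 := hβ1nn t ht
    have h2 := halnn t ht
    have h3 := hGnn t
    simp only [hR1]; positivity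
  set K := (1 + M) * Real.exp (∫ s in T0..T, R1 s) with hK
  have hK0 : 0 < K := by positivity
  set κ := ((2 * r)⁻¹).toReal with hκ
  have hκ0 : 0 ≤ κ := ENNReal.toReal_nonneg
  obtain ⟨L1, hL1int, hL1nn, hL1⟩ := hf1lip K hK0
  obtain ⟨L2, hL2int, hL2nn, hL2⟩ := hf2lip K hK0
  set R : ℝ → ℝ := fun t => 4 * κ * K * R1 t + 2 * L1 t + 2 * D * L2 t with hR
  have hRint : IntervalIntegrable R volume T0 T :=
    ((hR1int.const_mul _).add (hL1int.const_mul _)).add (hL2int.const_mul _)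
  have hRnn : ∀ t ∈ Icc T0 T, 0 ≤ R t := by
    intro t ht
    have h1 := hR1nn t ht
    have h2 := hL1nn t ht
    have h3 := hL2nn t ht
    simp only [hR]; positivity
  -- facts about a single solution
  have hsol : ∀ x x' : ℝ → H, ‖x T0‖ ≤ M → IsIDSweepingSol T0 T C f1 f2 x x' →
      (∀ t ∈ Icc T0 T, ‖x t‖ ≤ K) ∧
      (∀ᵐ t, t ∈ Icc T0 T → ‖-x' t - (f1 t (x t) + ∫ s in T0..t, f2 t s (x s))‖ ≤ R1 t * K) ∧
      (∀ᵐ t, t ∈ Icc T0 T → IntervalIntegrable (fun s => f2 t s (x s)) volume T0 t) := by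
    rintro x x' hM0 ⟨hi, hx, hxC, hN⟩
    set F : ℝ → H := fun t => f1 t (x t) + ∫ s in T0..t, f2 t s (x s) with hF
    have hN' : ∀ᵐ t, t ∈ Icc T0 T → (-x' t - F t) ∈ proxNormalCone (C t) (x t) := by
      filter_upwards [hN] with t h ht
      have := h ht
      rwa [sub_sub] at this
    have hz := zeta_bound hT hC hυint hυAC hmove hi hx hxC hN'
    have hxU : ∀ t ∈ Icc T0 T, x t ∈ ⋃ s ∈ Icc T0 T, C s := fun t ht =>
      mem_iUnion₂.2 ⟨t, ht, hxC t ht⟩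
    have hFb : ∀ᵐ t, t ∈ Icc T0 T → ∀ U, (∀ s ∈ Icc T0 t, ‖x s‖ ≤ U) →
        ‖F t‖ ≤ (β1 t + G t + al t * D) * (1 + U) := by
      filter_upwards [hG] with t hg ht U hU
      obtain ⟨hgi, hgG⟩ := hg ht
      have hU0 : 0 ≤ U := (norm_nonneg _).trans (hU t (right_mem_Icc.2 ht.1))
      have h1 : ‖f1 t (x t)‖ ≤ β1 t * (1 + U) :=
        (hf1grow t ht _ (hxU t ht)).trans (mul_le_mul_of_nonneg_left
          (add_le_add le_rfl (hU t (right_mem_Icc.2 ht.1))) (hβ1nn t ht))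
      have h2 : ‖∫ s in T0..t, f2 t s (x s)‖ ≤ ∫ s in T0..t, (g t s + al t * U) := by
        refine intervalIntegral.norm_integral_le_of_norm_le ht.1 ?_
          (hgi.add intervalIntegrable_const)
        refine Filter.Eventually.of_forall fun s hs => ?_
        have hs' : s ∈ Icc T0 t := ⟨hs.1.le, hs.2⟩
        refine (hf2grow' t ht s hs' _ (hxU s ⟨hs'.1, hs'.2.trans ht.2⟩)).trans ?_
        exact add_le_add le_rfl (mul_le_mul_of_nonneg_left (hU s hs') (halnn t ht))
      rw [intervalIntegral.integral_add hgi intervalIntegrable_const,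
        intervalIntegral.integral_const, smul_eq_mul] at h2
      have h3 : (t - T0) * (al t * U) ≤ D * (al t * U) :=
        mul_le_mul_of_nonneg_right (by linarith [ht.2]) (mul_nonneg (halnn t ht) hU0)
      have h4 := norm_add_le (f1 t (x t)) (∫ s in T0..t, f2 t s (x s))
      have h5 := mul_nonneg (hGnn t) hU0
      have h6 := mul_nonneg (halnn t ht) hD0.le
      simp only [hF]
      nlinarith
    have hap := apriori hT hi hx hR1int hR1nn (by
      filter_upwards [hz, hFb] with t hz hFb ht U hU
      have hU0 : 0 ≤ U := (norm_nonneg _).trans (hU t (right_mem_Icc.2 ht.1))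
      have h1 := hz ht
      have h2 := hFb ht U hU
      have h3 : ‖x' t‖ ≤ ‖-x' t - F t‖ + ‖F t‖ := by
        calc ‖x' t‖ = ‖(-x' t - F t) + F t‖ := by rw [sub_add_cancel, norm_neg]
          _ ≤ _ := norm_add_le _ _
      have h4 := mul_nonneg (abs_nonneg (υ' t)) hU0
      simp only [hR1]
      nlinarith)
    have hxK1 : ∀ t ∈ Icc T0 T, 1 + ‖x t‖ ≤ K := by
      intro t ht
      refine (hap t ht).trans (mul_le_mul_of_nonneg_right ?_ (Real.exp_pos _).le)
      linarith
    have hxK : ∀ t ∈ Icc T0 T, ‖x t‖ ≤ K := fun t ht => by linarith [hxK1 t ht]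
    have hcont := sol_continuousOn hT hi hx
    refine ⟨hxK, ?_, ?_⟩
    · filter_upwards [hz, hFb] with t hz hFb ht
      have h1 := hz ht
      have h2 := hFb ht (K - 1) (fun s hs => by linarith [hxK1 s ⟨hs.1, hs.2.trans ht.2⟩])
      rw [add_sub_cancel] at h2
      have hK1 : 1 ≤ K := by linarith [hxK1 t ht, norm_nonneg (x t)]
      have h3 : |υ' t| ≤ |υ' t| * K := le_mul_of_one_le_right (abs_nonneg _) hK1
      have h4 : 0 ≤ (β1 t + G t + al t * D) * K := (norm_nonneg _).trans h2
      simp only [hR1]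
      linarith
    · filter_upwards [hG] with t hg ht
      obtain ⟨hgi, -⟩ := hg ht
      have hsub : Icc T0 t ⊆ Icc T0 T := Icc_subset_Icc_right ht.2
      have hm := aesm_caratheodory (T0 := T0) (t := t) (η := K) (f2 t) (L2 t)
        (fun y => (hf2meas y).comp_measurable measurable_prodMk_left)
        (fun s hs => hL2 t ht s hs) x (hcont.mono hsub) hK0 (fun s hs => hxK s (hsub hs))
      have hb : IntervalIntegrable (fun s => g t s + al t * K) volume T0 t :=
        hgi.add intervalIntegrable_const
      rw [intervalIntegrable_iff_integrableOn_Ioc_of_le ht.1] at hb ⊢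
      refine Integrable.mono' hb (hm.mono_measure (Measure.restrict_mono Ioc_subset_Icc_self le_rfl)) ?_
      filter_upwards [ae_restrict_mem measurableSet_Ioc] with s hs
      have hs' : s ∈ Icc T0 t := ⟨hs.1.le, hs.2⟩
      refine (hf2grow' t ht s hs' _ (hxU s (hsub hs'))).trans ?_
      exact add_le_add le_rfl (mul_le_mul_of_nonneg_left (hxK s (hsub hs')) (halnn t ht))
  refine ⟨Real.exp ((∫ s in T0..T, R s) / 2), ?_⟩
  rintro a - b - haM hbM xa xa' xb xb' rfl rfl hsa hsb
  obtain ⟨hKa, hZa, hIa⟩ := hsol xa xa' haM hsa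
  obtain ⟨hKb, hZb, hIb⟩ := hsol xb xb' hbM hsb
  obtain ⟨hia, hxa, hCa, hNa⟩ := hsa
  obtain ⟨hib, hxb, hCb, hNb⟩ := hsb
  have hT0 : T0 ∈ Icc T0 T := left_mem_Icc.2 hT.le
  refine energy (w := fun t => xb t - xa t) (w' := fun t => xb' t - xa' t) hT (hib.sub hia) ?_
    hRint hRnn ?_
  · intro t ht
    rw [intervalIntegral.integral_sub (ii_mono hib hT0 ht) (ii_mono hia hT0 ht), hxb t ht, hxa t ht]
    abel
  filter_upwards [hZa, hZb, hIa, hIb, hNa, hNb] with t hza hzb hja hjb hna hnb ht W hW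
  have hW0 : 0 ≤ W := (norm_nonneg _).trans (hW t (right_mem_Icc.2 ht.1))
  have hWt := hW t (right_mem_Icc.2 ht.1)
  have hna := hna ht
  have hnb := hnb ht
  have hza := hza ht
  have hzb := hzb ht
  rw [sub_sub] at hna hnb
  set ζa := -xa' t - (f1 t (xa t) + ∫ s in T0..t, f2 t s (xa s)) with hζa
  set ζb := -xb' t - (f1 t (xb t) + ∫ s in T0..t, f2 t s (xb s)) with hζb
  have ca := cone_ineq (hC t ht).2.2 (hCa t ht) hna (hCb t ht)
  have cb := cone_ineq (hC t ht).2.2 (hCb t ht) hnb (hCa t ht)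
  have hsub : Icc T0 t ⊆ Icc T0 T := Icc_subset_Icc_right ht.2
  have d1 : ‖f1 t (xb t) - f1 t (xa t)‖ ≤ L1 t * W :=
    (hL1 t ht _ (by simpa using hKb t ht) _ (by simpa using hKa t ht)).trans
      (mul_le_mul_of_nonneg_left hWt (hL1nn t ht))
  have d2 : ‖(∫ s in T0..t, f2 t s (xb s)) - ∫ s in T0..t, f2 t s (xa s)‖ ≤ D * (L2 t * W) := by
    rw [← intervalIntegral.integral_sub (hjb ht) (hja ht)]
    have h1 : ‖∫ s in T0..t, (f2 t s (xb s) - f2 t s (xa s))‖ ≤ (L2 t * W) * |t - T0| := by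
      apply intervalIntegral.norm_integral_le_of_norm_le_const
      intro s hs
      rw [uIoc_of_le ht.1] at hs
      have hs' : s ∈ Icc T0 t := ⟨hs.1.le, hs.2⟩
      exact (hL2 t ht s hs' _ (by simpa using hKb s (hsub hs')) _
        (by simpa using hKa s (hsub hs'))).trans
        (mul_le_mul_of_nonneg_left (hW s hs') (hL2nn t ht))
    rw [abs_of_nonneg (sub_nonneg.2 ht.1)] at h1
    have h2 : (L2 t * W) * (t - T0) ≤ (L2 t * W) * D :=
      mul_le_mul_of_nonneg_left (by linarith [ht.2]) (mul_nonneg (hL2nn t ht) hW0)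
    linarith
  set P := (f1 t (xb t) - f1 t (xa t)) with hP
  set P2 := ((∫ s in T0..t, f2 t s (xb s)) - ∫ s in T0..t, f2 t s (xa s)) with hP2
  have hw' : xb' t - xa' t = ζa - ζb - P - P2 := by
    rw [hζa, hζb, hP, hP2]; abel
  have hneg : xa t - xb t = -(xb t - xa t) := by abel
  rw [hneg, inner_neg_right, norm_neg] at cb
  rw [hw']
  set w := xb t - xa t with hw
  have e1 : ⟪w, ζa - ζb - P - P2⟫ = ⟪ζa, w⟫ - ⟪ζb, w⟫ - ⟪w, P⟫ - ⟪w, P2⟫ := by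
    rw [inner_sub_right, inner_sub_right, inner_sub_right, real_inner_comm w ζa,
      real_inner_comm w ζb]
  have e2 : -⟪w, P⟫ ≤ W * (L1 t * W) := by
    have := (abs_le.1 (abs_real_inner_le_norm w P)).1
    have := mul_le_mul hWt d1 (norm_nonneg _) hW0
    linarith
  have e3 : -⟪w, P2⟫ ≤ W * (D * (L2 t * W)) := by
    have := (abs_le.1 (abs_real_inner_le_norm w P2)).1
    have := mul_le_mul hWt d2 (norm_nonneg _) hW0
    linarith
  have hw2 : ‖w‖ ^ 2 ≤ W ^ 2 := pow_le_pow_left₀ (norm_nonneg _) hWt 2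
  have bnd : ∀ z : H, ‖z‖ ≤ R1 t * K → κ * ‖z‖ * ‖w‖ ^ 2 ≤ κ * (R1 t * K) * W ^ 2 := by
    intro z hz
    have := hR1nn t ht
    gcongr
  have ca' := ca.trans (bnd _ hza)
  have cb' := cb.trans (bnd _ hzb)
  rw [e1]
  simp only [hR]
  linarith
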